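/- Let G be a C_{4k}-free bipartite graph. Every vector in the null space of the adjacency matrix of G vanishes on all vertices outside C_S(G), and the restriction map to the vertex set of C_S(G) is a linear isomorphism from Null(G) onto Null(C_S(G)). In particular, the nullity of G equals the nullity of C_S(G). -/

import Mathlib

open scoped Classical

namespace C4kPaper

open SimpleGraph

variable {V : Type*} [Fintype V] [DecidableEq V]

/-- The null space of the adjacency matrix of `G`, as a set of vectors. -/
noncomputable def nullSet (G : SimpleGraph V) : Set (V → ℝ) :=
  {x | Matrix.mulVec (G.adjMatrix ℝ) x = 0}

/-- The null space of the adjacency matrix of `G`, as a submodule of `ℝ^V`. -/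
noncomputable def nullModule (G : SimpleGraph V) : Submodule ℝ (V → ℝ) :=
  LinearMap.ker (G.adjMatrix ℝ).mulVecLin

/-- The nullity of `G`: the dimension of the null space of its adjacency matrix. -/
noncomputable def nullity (G : SimpleGraph V) : ℕ :=
  Module.finrank ℝ (nullModule G)

/-- The rank of the adjacency matrix of `G` over `ℝ`. -/
noncomputable def rk (G : SimpleGraph V) : ℕ :=
  (G.adjMatrix ℝ).rank

/-- The support of `G`: vertices where some null space vector is nonzero. -/
def supp (G : SimpleGraph V) : Set V :=
  {v | ∃ x ∈ nullSet G, x v ≠ 0}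

/-- The core of `G`: the neighbors of the support. -/
def core (G : SimpleGraph V) : Set V :=
  {u | ∃ v ∈ supp G, G.Adj u v}

/-- The N-part of `G`: vertices neither in the support nor in the core. -/
def npart (G : SimpleGraph V) : Set V :=
  (supp G ∪ core G)ᶜ

/-- `G` is bipartite. -/
def IsBipartite (G : SimpleGraph V) : Prop :=
  ∃ s : Set V, ∀ ⦃u v : V⦄, G.Adj u v → (u ∈ s ↔ v ∉ s)

/-- `G` has no cycle whose length is a multiple of 4. -/
def C4kFree (G : SimpleGraph V) : Prop :=
  ∀ (v : V) (c : G.Walk v v), c.IsCycle → ¬ (4 ∣ c.length)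

/-- `M` is a maximum matching of `G`. -/
def IsMaximumMatching (G : SimpleGraph V) (M : G.Subgraph) : Prop :=
  M.IsMatching ∧ ∀ M' : G.Subgraph, M'.IsMatching → M'.edgeSet.ncard ≤ M.edgeSet.ncard

/-- The matching number of `G`. -/
noncomputable def matchNum (G : SimpleGraph V) : ℕ :=
  sSup {n | ∃ M : G.Subgraph, M.IsMatching ∧ M.edgeSet.ncard = n}

/-- `s` is an independent set of `G`. -/
def IsIndep (G : SimpleGraph V) (s : Set V) : Prop :=
  ∀ ⦃u⦄, u ∈ s → ∀ ⦃w⦄, w ∈ s → ¬ G.Adj u w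

/-- `s` is a maximum independent set of `G`. -/
def IsMaxIndep (G : SimpleGraph V) (s : Set V) : Prop :=
  IsIndep G s ∧ ∀ t : Set V, IsIndep G t → t.ncard ≤ s.ncard

/-- The independence number of `G`. -/
noncomputable def indepNum (G : SimpleGraph V) : ℕ :=
  sSup {n | ∃ s : Set V, IsIndep G s ∧ s.ncard = n}

/-- An `(M,x)`-alternating walk `w₀, w₁, …, w_j` (here `w_i = p.getVert i`):
for all `0 ≤ i < ⌊(j-1)/2⌋`, `{w_{2i}, w_{2i+1}} ∈ M` and `x_{w_{2i}} · x_{w_{2i+2}} < 0`. -/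
def MxAltWalk (G : SimpleGraph V) (M : G.Subgraph) (x : V → ℝ) {v u : V}
    (p : G.Walk v u) : Prop :=
  ∀ i : ℕ, i < (p.length - 1) / 2 →
    M.Adj (p.getVert (2 * i)) (p.getVert (2 * i + 1)) ∧
      x (p.getVert (2 * i)) * x (p.getVert (2 * i + 2)) < 0

/-- A maximal `(M,x)`-alternating walk: one not properly contained in a longer
`(M,x)`-alternating walk from the same start. -/
def MaximalMxAltWalk (G : SimpleGraph V) (M : G.Subgraph) (x : V → ℝ) {v u : V}
    (p : G.Walk v u) : Prop :=
  MxAltWalk G M x p ∧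
    ∀ (u' : V) (q : G.Walk v u'), MxAltWalk G M x q → p.support <+: q.support →
      q.length = p.length

/-- An `M`-alternating walk starting with an edge not in `M`:
the `i`-th edge belongs to `M` iff `i` is odd. -/
def MAltWalk (G : SimpleGraph V) (M : G.Subgraph) {v u : V} (p : G.Walk v u) : Prop :=
  ∀ i : ℕ, i < p.length → (M.Adj (p.getVert i) (p.getVert (i + 1)) ↔ Odd i)

/-- Vertices reachable from `v` by an even-length `M`-alternating path. -/
def Re (G : SimpleGraph V) (M : G.Subgraph) (v : V) : Set V :=
  {u | ∃ p : G.Walk v u, p.IsPath ∧ MAltWalk G M p ∧ Even p.length}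

/-- Vertices reachable from `v` by an odd-length `M`-alternating path. -/
def Ro (G : SimpleGraph V) (M : G.Subgraph) (v : V) : Set V :=
  {u | ∃ p : G.Walk v u, p.IsPath ∧ MAltWalk G M p ∧ Odd p.length}


theorem exists_isCycle_of_injOn {W : Type*} (G : SimpleGraph W) {n : ℕ} (hn : 2 < n)
    (w : ℕ → W) (hinj : Set.InjOn w (Set.Iio n)) (hadj : ∀ i, G.Adj (w i) (w (i + 1)))
    (hw : w n = w 0) :
    ∃ (v : W) (c : G.Walk v v), c.IsCycle ∧ c.length = n := by
  obtain ⟨m, rfl⟩ : ∃ m, n = m + 2 := ⟨n - 2, by omega⟩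
  have key : ∀ a b : Fin (m + 2), b = a + 1 → G.Adj (w a) (w b) := by
    rintro a b rfl
    rw [Fin.val_add_one]
    split_ifs with h
    · have := hadj a
      rw [h] at this ⊢
      simpa [hw] using this
    · exact hadj a
  refine (cycleGraph_isContained_iff hn).1 ⟨⟨⟨fun i => w i, ?_⟩, ?_⟩⟩
  · intro a b hab
    rcases cycleGraph_adj.1 hab with h | h
    · exact (key b a (by rw [← h]; abel)).symm
    · exact key a b (by rw [← h]; abel)
  · intro a b hab
    exact Fin.ext (hinj a.2 b.2 hab)

/-- In a graph without cycles of length divisible by `4`, a vector supported on one side of a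
bipartition vanishes if its support can be matched into vertices where its image under the
adjacency matrix is zero. -/
theorem eq_zero_of_matching_of_side (G : SimpleGraph V) (hc : C4kFree G) (s : Set V)
    (hs : ∀ ⦃u v : V⦄, G.Adj u v → (u ∈ s ↔ v ∉ s)) (x : V → ℝ) (hx : ∀ v, x v ≠ 0 → v ∈ s)
    (f : V → V) (hf : Set.InjOn f {v | x v ≠ 0}) (hadj : ∀ v, x v ≠ 0 → G.Adj v (f v))
    (hsum : ∀ v, x v ≠ 0 → ∑ u ∈ G.neighborFinset (f v), x u = 0) : x = 0 := by
  by_contra hne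
  obtain ⟨v₀, hv₀⟩ := Function.ne_iff.1 hne
  have step : ∀ v : {v // x v ≠ 0}, ∃ u : {v // x v ≠ 0}, G.Adj (f v) u ∧ x v * x u < 0 := by
    rintro ⟨v, hv⟩
    by_contra! hcon
    have hnonneg : ∀ u ∈ G.neighborFinset (f v), 0 ≤ x v * x u := by
      intro u hu
      by_cases hxu : x u = 0
      · simp [hxu]
      · exact hcon ⟨u, hxu⟩ (by simpa using hu)
    have hzero : ∑ u ∈ G.neighborFinset (f v), x v * x u = 0 := by
      rw [← Finset.mul_sum, hsum v hv, mul_zero]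
    have := (Finset.sum_eq_zero_iff_of_nonneg hnonneg).1 hzero v
      (by simpa using (hadj v hv).symm)
    exact hv (mul_self_eq_zero.1 this)
  choose g hg hneg using step
  obtain ⟨a, ha⟩ : ∃ a, a ∈ Function.periodicPts g := by
    obtain ⟨i, j, hij, h⟩ := Finite.exists_ne_map_eq_of_infinite fun n : ℕ => g^[n] ⟨v₀, hv₀⟩
    wlog hlt : i < j generalizing i j
    · exact this j i hij.symm h.symm (by omega)
    refine ⟨g^[i] ⟨v₀, hv₀⟩, Function.mk_mem_periodicPts (n := j - i) (by omega) ?_⟩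
    rw [Function.IsPeriodicPt, Function.IsFixedPt, ← Function.iterate_add_apply,
      Nat.sub_add_cancel hlt.le]
    exact h.symm
  have hpos := Function.minimalPeriod_pos_of_mem_periodicPts ha
  have hper : g^[Function.minimalPeriod g a] a = a := Function.iterate_minimalPeriod
  have hinj : Set.InjOn (g^[·] a) (Set.Iio (Function.minimalPeriod g a)) :=
    Function.iterate_injOn_Iio_minimalPeriod
  generalize Function.minimalPeriod g a = p at hpos hper hinj
  have hsign : ∀ n : ℕ, 0 < (-1) ^ n * (x a * x (g^[n] a)) := by
    intro n
    induction n with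
    | zero => simpa using mul_self_pos.2 a.2
    | succ n ih =>
      rw [Function.iterate_succ_apply']
      have h₁ := hneg (g^[n] a)
      have h₂ := mul_neg_of_pos_of_neg ih h₁
      have h₃ : 0 < x (g^[n] a) ^ 2 := by have := (g^[n] a).2; positivity
      rw [pow_succ]
      by_contra! h₄
      nlinarith [mul_nonneg_of_nonpos_of_nonpos h₄ (neg_nonpos.2 h₃.le)]
  have heven : Even p := by
    by_contra h
    have := hsign p
    rw [hper, (Nat.not_even_iff_odd.1 h).neg_one_pow] at this
    nlinarith [mul_self_nonneg (x a)]
  let w : ℕ → V := fun k => if Even k then (g^[k / 2] a : V) else f (g^[k / 2] a)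
  have hmem : ∀ n, (g^[n] a : V) ∈ s := fun n => hx _ (g^[n] a).2
  have hmem' : ∀ n, f (g^[n] a) ∉ s := fun n => (hs (hadj _ (g^[n] a).2)).1 (hmem n)
  have hw_even : ∀ n, w (2 * n) = g^[n] a := fun n => by simp [w]
  have hw_odd : ∀ n, w (2 * n + 1) = f (g^[n] a) := fun n => by
    have : (2 * n + 1) / 2 = n := by omega
    simp [w, this]
  obtain ⟨v, c, hcyc, hlen⟩ := exists_isCycle_of_injOn G (n := 2 * p)
    (by obtain ⟨q, rfl⟩ := heven; omega) w
    (by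
      intro i hi j hj hij
      simp only [Set.mem_Iio] at hi hj
      obtain ⟨k, rfl | rfl⟩ := Nat.even_or_odd' i <;> obtain ⟨l, rfl | rfl⟩ := Nat.even_or_odd' j <;>
        simp only [hw_even, hw_odd] at hij
      · have := hinj (Set.mem_Iio.2 (by omega)) (Set.mem_Iio.2 (by omega)) (Subtype.ext hij)
        omega
      · exact absurd (hij ▸ hmem k) (hmem' l)
      · exact absurd (hij ▸ hmem l) (hmem' k)
      · have := hinj (Set.mem_Iio.2 (by omega)) (Set.mem_Iio.2 (by omega))
          (Subtype.ext (hf (g^[k] a).2 (g^[l] a).2 hij))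
        omega)
    (by
      intro i
      obtain ⟨k, rfl | rfl⟩ := Nat.even_or_odd' i
      · rw [hw_even, hw_odd]
        exact hadj _ (g^[k] a).2
      · rw [hw_odd, show 2 * k + 1 + 1 = 2 * (k + 1) by ring, hw_even,
          Function.iterate_succ_apply']
        exact hg _)
    (by rw [hw_even]; exact (congrArg Subtype.val hper).trans (hw_even 0).symm)
  refine hc v c hcyc ?_
  obtain ⟨q, rfl⟩ := heven
  exact ⟨q, by omega⟩

theorem eq_zero_of_matching (G : SimpleGraph V) (hb : IsBipartite G) (hc : C4kFree G)
    (x : V → ℝ) (f : V → V) (hf : Set.InjOn f {v | x v ≠ 0})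
    (hadj : ∀ v, x v ≠ 0 → G.Adj v (f v))
    (hsum : ∀ v, x v ≠ 0 → ∑ u ∈ G.neighborFinset (f v), x u = 0) : x = 0 := by
  obtain ⟨s, hs⟩ := hb
  have side : ∀ t : Set V, (∀ ⦃u v : V⦄, G.Adj u v → (u ∈ t ↔ v ∉ t)) → t.indicator x = 0 := by
    intro t ht
    have hsupp : ∀ v, t.indicator x v ≠ 0 → v ∈ t ∧ x v ≠ 0 := fun v hv => by
      simpa [Set.indicator_apply] using hv
    refine eq_zero_of_matching_of_side G hc t ht _ (fun v hv => (hsupp v hv).1) f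
      (hf.mono fun v hv => (hsupp v hv).2) (fun v hv => hadj v (hsupp v hv).2) fun v hv => ?_
    rw [← hsum v (hsupp v hv).2]
    refine Finset.sum_congr rfl fun u hu => Set.indicator_of_mem ?_ x
    have h₁ := ht (hadj v (hsupp v hv).2)
    have h₂ := ht ((G.mem_neighborFinset _ _).1 hu)
    have h₃ := (hsupp v hv).1
    tauto
  have h₁ := side s hs
  have h₂ := side sᶜ fun u v h => by simpa using not_congr (hs h)
  rw [← Set.indicator_self_add_compl s x, h₁, h₂, add_zero]

/-- A vector that is nonzero, supported on `S` and whose image under the adjacency matrix vanishes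
on `T` yields a violation of Hall's condition for matching `S` into `T`. -/
theorem exists_card_lt_of_ne_zero (G : SimpleGraph V) (hb : IsBipartite G) (hc : C4kFree G)
    (S T : Finset V) (x : V → ℝ) (hx : x ≠ 0) (hS : ∀ v, x v ≠ 0 → v ∈ S)
    (hT : ∀ v ∈ T, ∑ u ∈ G.neighborFinset v, x u = 0) :
    ∃ A ⊆ S, (T.filter fun b => ∃ a ∈ A, G.Adj a b).card < A.card := by
  by_contra! hall
  obtain ⟨f, hf, hfT⟩ := (Finset.all_card_le_biUnion_card_iff_exists_injective
    fun a : S => T.filter fun b => G.Adj a b).1 (by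
      intro B
      have := hall (B.map (Function.Embedding.subtype _)) (by
        intro v hv
        obtain ⟨b, -, rfl⟩ := Finset.mem_map.1 hv
        exact b.2)
      rw [Finset.card_map] at this
      refine this.trans (Finset.card_le_card fun v hv => ?_)
      simpa [and_assoc, and_left_comm] using hv)
  obtain ⟨F, hF⟩ : ∃ F : V → V, ∀ v : S, F v = f v :=
    ⟨fun v => if h : v ∈ S then f ⟨v, h⟩ else v, fun v => dif_pos v.2⟩
  have hFT : ∀ v, x v ≠ 0 → F v ∈ T ∧ G.Adj v (F v) := fun v hv => by
    rw [hF ⟨v, hS v hv⟩]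
    simpa using hfT ⟨v, hS v hv⟩
  refine hx (eq_zero_of_matching G hb hc x F (fun u hu v hv huv => ?_)
    (fun v hv => (hFT v hv).2) fun v hv => hT _ (hFT v hv).1)
  rw [hF ⟨u, hS u hu⟩, hF ⟨v, hS v hv⟩] at huv
  exact congrArg Subtype.val (hf huv)

theorem mem_nullSet_iff {W : Type*} [Fintype W] (G : SimpleGraph W) (x : W → ℝ) :
    x ∈ nullSet G ↔ ∀ v, ∑ u ∈ G.neighborFinset v, x u = 0 := by
  simp [nullSet, funext_iff]

theorem eq_zero_of_notMem_supp {W : Type*} [Fintype W] (G : SimpleGraph W) {x : W → ℝ}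
    (hx : x ∈ nullSet G) {v : W} (hv : v ∉ supp G) : x v = 0 := by
  by_contra h
  exact hv ⟨x, hx, h⟩

/-- Subsets of the core satisfy Hall's condition for matching the core into the support. -/
theorem card_le_card_supp_neighbors (G : SimpleGraph V) (hb : IsBipartite G) (hc : C4kFree G)
    (A : Finset V) (hA : ∀ v ∈ A, v ∈ core G) :
    A.card ≤ ((supp G).toFinset.filter fun b => ∃ a ∈ A, G.Adj a b).card := by
  let N : Finset V → Finset V := fun A => (supp G).toFinset.filter fun b => ∃ a ∈ A, G.Adj a b
  obtain ⟨B, hB, hmax⟩ := ((core G).toFinset.powerset).exists_max_image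
    (fun A => (A.card : ℤ) - (N A).card) ⟨∅, by simp⟩
  have hBcore : B ⊆ (core G).toFinset := Finset.mem_powerset.1 hB
  suffices hNB : N B = ∅ by
    have hBe : B = ∅ := by
      rw [Finset.eq_empty_iff_forall_notMem]
      intro u hu
      obtain ⟨t, ht, hut⟩ : u ∈ core G := by simpa using hBcore hu
      have : t ∈ N B := by simpa [N, ht] using ⟨u, hu, hut⟩
      simp [hNB] at this
    have := hmax A (Finset.mem_powerset.2 fun v hv => by simpa using hA v hv)
    simp only [hBe, Finset.card_empty] at this
    change A.card ≤ (N A).card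
    omega
  rw [Finset.eq_empty_iff_forall_notMem]
  intro t ht
  obtain ⟨c, hc₀, hct⟩ : t ∈ supp G := by simpa using (Finset.mem_filter.1 ht).1
  obtain ⟨D, hD, hcard⟩ := exists_card_lt_of_ne_zero G hb hc (N B) B
    ((N B : Set V).indicator c)
    (fun h => hct (by simpa [Set.indicator_of_mem (Finset.mem_coe.2 ht)] using congrFun h t))
    (fun v hv => by
      by_contra h
      exact hv (Set.indicator_of_notMem (by simpa using h) c))
    (fun v hv => by
      rw [← (mem_nullSet_iff G c).1 hc₀ v]
      refine Finset.sum_congr rfl fun u hu => ?_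
      by_cases hu' : u ∈ supp G
      · refine Set.indicator_of_mem ?_ c
        simpa [N, hu'] using ⟨v, hv, by simpa using hu⟩
      · rw [Set.indicator_apply, eq_zero_of_notMem_supp G hc₀ hu', ite_self])
  set E := B.filter fun b => ∃ a ∈ D, G.Adj a b with hE
  have hEB : E ⊆ B := Finset.filter_subset _ _
  have hNE : N (B \ E) ⊆ N B \ D := by
    intro v hv
    simp only [N, Finset.mem_filter, Finset.mem_sdiff] at hv ⊢
    obtain ⟨hvs, u, ⟨huB, huE⟩, huv⟩ := hv
    refine ⟨⟨hvs, u, huB, huv⟩, fun hvD => huE ?_⟩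
    exact Finset.mem_filter.2 ⟨huB, v, hvD, huv.symm⟩
  have h₁ := hmax (B \ E) (Finset.mem_powerset.2 (Finset.sdiff_subset.trans hBcore))
  have h₂ := Finset.card_le_card hNE
  have h₃ := Finset.card_sdiff_add_card_eq_card hD
  have h₄ := Finset.card_sdiff_add_card_eq_card hEB
  omega

/-- A vector whose image under the adjacency matrix vanishes on the support vanishes on the
core. -/
theorem eq_zero_of_mem_core (G : SimpleGraph V) (hb : IsBipartite G) (hc : C4kFree G)
    {y : V → ℝ} (hy : ∀ v ∈ supp G, ∑ u ∈ G.neighborFinset v, y u = 0) {v : V}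
    (hv : v ∈ core G) : y v = 0 := by
  by_contra hyv
  obtain ⟨A, hA, hcard⟩ := exists_card_lt_of_ne_zero G hb hc (core G).toFinset (supp G).toFinset
    ((core G).indicator y)
    (fun h => hyv (by simpa [Set.indicator_of_mem hv] using congrFun h v))
    (fun u hu => by
      by_contra h
      exact hu (Set.indicator_of_notMem (by simpa using h) y))
    (fun u hu => by
      have hu' : u ∈ supp G := by simpa using hu
      rw [← hy u hu']
      refine Finset.sum_congr rfl fun w hw => Set.indicator_of_mem ?_ y
      exact ⟨u, hu', ((G.mem_neighborFinset _ _).1 hw).symm⟩)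
  exact hcard.not_ge (card_le_card_supp_neighbors G hb hc A fun u hu => by simpa using hA hu)

theorem sum_neighborFinset_induce {W : Type*} [Fintype W] (G : SimpleGraph W) (s : Set W)
    [Fintype s] (x : W → ℝ) (hx : ∀ v, v ∉ s → x v = 0) (v : s) :
    ∑ u ∈ (G.induce s).neighborFinset v, x u = ∑ u ∈ G.neighborFinset v, x u := by
  refine Finset.sum_bij_ne_zero (fun u _ _ => (u : W)) ?_ ?_ ?_ ?_
  · intro u hu _
    simpa using hu
  · intro u _ _ w _ _ h
    exact Subtype.ext h
  · intro u hu hxu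
    have hus : u ∈ s := by
      by_contra h
      exact hxu (hx u h)
    exact ⟨⟨u, hus⟩, by simpa using hu, hxu, rfl⟩
  · intro u _ _
    rfl

theorem mem_nullModule_iff {W : Type*} [Fintype W] [DecidableEq W] (G : SimpleGraph W)
    (x : W → ℝ) : x ∈ nullModule G ↔ ∀ v, ∑ u ∈ G.neighborFinset v, x u = 0 := by
  simp [nullModule, funext_iff]

/-- Null vectors of the subgraph induced by the support and the core extend by zero to null
vectors of the whole graph. -/
theorem extend_mem_nullModule (G : SimpleGraph V) (hb : IsBipartite G) (hc : C4kFree G)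
    {x : V → ℝ} (hx : ∀ v, v ∉ supp G ∪ core G → x v = 0)
    (hx' : ∀ v ∈ supp G ∪ core G, ∑ u ∈ G.neighborFinset v, x u = 0) : x ∈ nullModule G := by
  rw [mem_nullModule_iff]
  intro v
  by_cases hv : v ∈ supp G ∪ core G
  · exact hx' v hv
  · refine Finset.sum_eq_zero fun u hu => ?_
    have hvu := (G.mem_neighborFinset _ _).1 hu
    by_cases hus : u ∈ supp G
    · exact absurd (Or.inr ⟨u, hus, hvu⟩) hv
    by_cases huc : u ∈ core G
    · exact eq_zero_of_mem_core G hb hc (fun w hw => hx' w (Or.inl hw)) huc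
    · exact hx u (by simp [hus, huc])

theorem exists_restrict_linearEquiv (G : SimpleGraph V) (hb : IsBipartite G) (hc : C4kFree G) :
    ∃ e : nullModule G ≃ₗ[ℝ] nullModule (G.induce (supp G ∪ core G)),
      ∀ (x : nullModule G) (v : (supp G ∪ core G : Set V)),
        (e x : (supp G ∪ core G : Set V) → ℝ) v = (x : V → ℝ) v := by
  have hvanish : ∀ x : nullModule G, ∀ v, v ∉ supp G ∪ core G → (x : V → ℝ) v = 0 :=
    fun x v hv => eq_zero_of_notMem_supp G (LinearMap.mem_ker.1 x.2) fun h => hv (Or.inl h)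
  let L : nullModule G →ₗ[ℝ] nullModule (G.induce (supp G ∪ core G)) :=
    ((LinearMap.funLeft ℝ ℝ Subtype.val).comp (nullModule G).subtype).codRestrict _ fun x => by
      rw [mem_nullModule_iff]
      intro v
      exact (sum_neighborFinset_induce G _ x (hvanish x) v).trans
        ((mem_nullModule_iff G x).1 x.2 v)
  have hL : ∀ x v, (L x : (supp G ∪ core G : Set V) → ℝ) v = (x : V → ℝ) v := fun _ _ => rfl
  refine ⟨LinearEquiv.ofBijective L ⟨fun x y hxy => ?_, fun y => ?_⟩, hL⟩
  · ext v
    by_cases hv : v ∈ supp G ∪ core G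
    · rw [← hL x ⟨v, hv⟩, hxy, hL]
    · rw [hvanish x v hv, hvanish y v hv]
  · let z : V → ℝ := fun v =>
      if h : v ∈ supp G ∪ core G then (y : (supp G ∪ core G : Set V) → ℝ) ⟨v, h⟩ else 0
    have hz : ∀ v, v ∉ supp G ∪ core G → z v = 0 := fun v hv => dif_neg hv
    have hzy : ∀ v : (supp G ∪ core G : Set V), z v = (y : (supp G ∪ core G : Set V) → ℝ) v :=
      fun v => dif_pos v.2
    refine ⟨⟨z, extend_mem_nullModule G hb hc hz fun v hv => ?_⟩, Subtype.ext (funext hzy)⟩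
    rw [← sum_neighborFinset_induce G _ z hz ⟨v, hv⟩]
    simp only [hzy]
    exact (mem_nullModule_iff _ _).1 y.2 ⟨v, hv⟩

/-- null vectors vanish outside `C_S(G)` and restriction is a linear
isomorphism from `Null(G)` onto `Null(C_S(G))`; in particular the nullities agree. -/
theorem stmt16 (G : SimpleGraph V) (hb : IsBipartite G) (hc : C4kFree G) :
    (∀ x ∈ nullSet G, ∀ v : V, v ∉ supp G ∪ core G → x v = 0) ∧
    (∃ e : nullModule G ≃ₗ[ℝ] nullModule (G.induce (supp G ∪ core G)),
      ∀ (x : nullModule G) (v : (supp G ∪ core G : Set V)),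
        (e x : (supp G ∪ core G : Set V) → ℝ) v = (x : V → ℝ) v) ∧
    nullity G = nullity (G.induce (supp G ∪ core G)) := by
  obtain ⟨e, he⟩ := exists_restrict_linearEquiv G hb hc
  exact ⟨fun x hx v hv => eq_zero_of_notMem_supp G hx fun h => hv (Or.inl h), ⟨e, he⟩,
    e.finrank_eq⟩

end C4kPaper
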